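/- arXiv:0911.5599 — 2 statements merged into one kernel-verified Lean document; each statement's English description precedes it below -/
import Mathlib

section
/- Let 2 < p < 4, m > 0, e > 0, and let g(p) = √((p-2)(4-p)) if 2 < p < 3 and g(p) = 1 if 3 ≤ p < 4. If 0 < ω < g(p)·m, then there exists a real number α with (2-p)/(2(6-p)) < α < 1/6 such that for every real t with 0 ≤ t ≤ ω/e one has A_{p,α}·e²t² + B_{p,α}·eωt + C_{p,α}·(m² - ω²) ≥ 0. -/
/-- Coefficient `A_{p,α} = (1 + 2α(p-3))/p`. -/
noncomputable def Acoef (p α : ℝ) : ℝ := (1 + 2*α*(p-3)) / p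

/-- Coefficient `B_{p,α} = (p - 10αp - 4 + 24α)/(2p)`. -/
noncomputable def Bcoef (p α : ℝ) : ℝ := (p - 10*α*p - 4 + 24*α) / (2*p)

/-- Coefficient `C_{p,α} = ((p-2)(1-6α))/(2p)`. -/
noncomputable def Ccoef (p α : ℝ) : ℝ := ((p-2)*(1-6*α)) / (2*p)

/-- The function `g(p)` of Theorem 1. -/
noncomputable def gfun (p : ℝ) : ℝ := if p < 3 then Real.sqrt ((p-2)*(4-p)) else 1

/-- At the left endpoint of the range of `α`, the normalised quadratic is bounded below on `s ≥ 0`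
by a positive constant. -/
lemma exists_pos_le_endpoint_quadratic (p m ω : ℝ) (hp2 : 2 < p) (hp4 : p < 4)
    (hω0 : 0 < ω) (hω : ω < gfun p * m) :
    0 < m^2/ω^2 - 1 ∧ ∃ δ : ℝ, 0 < δ ∧ δ ≤ 2 * (m^2/ω^2 - 1) ∧ ∀ s : ℝ, 0 ≤ s →
      δ ≤ (4-p)*s^2 - 2*(3-p)*s + (p-2)*(m^2/ω^2 - 1) := by
  have hω2 : 0 < ω^2 := by positivity
  rcases lt_or_ge p 3 with h | h
  · rw [gfun, if_pos h] at hω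
    have hg : 0 < (p-2)*(4-p) := mul_pos (by linarith) (by linarith)
    have hsq : ω^2 < (p-2)*(4-p)*m^2 := by
      have := pow_lt_pow_left₀ hω hω0.le two_ne_zero
      rwa [mul_pow, Real.sq_sqrt hg.le] at this
    have hr : 1 < (p-2)*(4-p)*(m^2/ω^2) := by
      rw [← mul_div_assoc, one_lt_div hω2]
      exact hsq
    generalize m^2/ω^2 = r at hr ⊢
    have hr1 : 0 < r - 1 := by nlinarith [sq_nonneg (p-3)]
    have hp : 0 < 4 - p := by linarith
    refine ⟨hr1, (p-2)*(r-1) - (3-p)^2/(4-p), ?_, ?_, fun s _ => ?_⟩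
    · rw [sub_pos, div_lt_iff₀ hp]
      nlinarith
    · have : 0 ≤ (3-p)^2/(4-p) := by positivity
      nlinarith
    · have : (4-p)*s^2 - 2*(3-p)*s + (3-p)^2/(4-p) = ((4-p)*s - (3-p))^2/(4-p) := by
        field_simp
        ring
      have : 0 ≤ ((4-p)*s - (3-p))^2/(4-p) := by positivity
      linarith
  · rw [gfun, if_neg h.not_gt, one_mul] at hω
    have hr : 1 < m^2/ω^2 := by
      rw [one_lt_div hω2]
      exact pow_lt_pow_left₀ hω hω0.le two_ne_zero
    refine ⟨by linarith, (p-2)*(m^2/ω^2-1), mul_pos (by linarith) (by linarith),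
      by nlinarith, fun s hs => ?_⟩
    have h1 : 0 ≤ (4-p)*s^2 := mul_nonneg (by linarith) (sq_nonneg s)
    have h2 : 0 ≤ (p-3)*s := mul_nonneg (by linarith) hs
    linarith

theorem key_inequality (p m e ω : ℝ) (hp2 : 2 < p) (hp4 : p < 4)
    (hm : 0 < m) (he : 0 < e) (hω0 : 0 < ω) (hω : ω < gfun p * m) :
    ∃ α : ℝ, (2-p)/(2*(6-p)) < α ∧ α < 1/6 ∧
      ∀ t : ℝ, 0 ≤ t → t ≤ ω/e →
        Acoef p α * e^2 * t^2 + Bcoef p α * (e*ω) * t + Ccoef p α * (m^2 - ω^2) ≥ 0 := by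
  obtain ⟨hM, δ, hδ0, hδM, hδ⟩ := exists_pos_le_endpoint_quadratic p m ω hp2 hp4 hω0 hω
  have hmM : m^2 - ω^2 = ω^2 * (m^2/ω^2 - 1) := by
    field_simp
  rw [hmM]
  generalize m^2/ω^2 - 1 = M at hM hδM hδ
  have hp6 : 0 < 6 - p := by linarith
  have hK : 0 < 20 + 12*M := by linarith
  set ε := δ/(20 + 12*M) with hε
  have hε0 : 0 < ε := by positivity
  have hεK : ε*(20 + 12*M) = δ := div_mul_cancel₀ _ hK.ne'
  have hε6 : ε < 1/6 := by
    rw [hε, div_lt_iff₀ hK]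
    linarith
  refine ⟨(2-p)/(2*(6-p)) + ε, by linarith, ?_, fun t ht0 ht => ?_⟩
  · have : (2-p)/(2*(6-p)) < 0 := div_neg_of_neg_of_pos (by linarith) (by linarith)
    linarith
  · obtain ⟨s, rfl⟩ : ∃ s, t = s*ω/e := ⟨t*e/ω, by field_simp⟩
    have hs0 : 0 ≤ s := by
      by_contra! hs
      have : s*ω/e < 0 := div_neg_of_neg_of_pos (mul_neg_of_neg_of_pos hs hω0) he
      linarith
    have hs1 : s ≤ 1 := by
      rw [div_le_div_iff_of_pos_right he] at ht
      nlinarith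
    have key : Acoef p ((2-p)/(2*(6-p)) + ε) * e^2 * (s*ω/e)^2
        + Bcoef p ((2-p)/(2*(6-p)) + ε) * (e*ω) * (s*ω/e)
        + Ccoef p ((2-p)/(2*(6-p)) + ε) * (ω^2 * M)
        = ω^2/(2*p) * (2*p/(6-p) * ((4-p)*s^2 - 2*(3-p)*s + (p-2)*M)
          + ε*(4*(p-3)*s^2 - (10*p-24)*s - 6*(p-2)*M)) := by
      unfold Acoef Bcoef Ccoef
      field_simp
      ring
    rw [key]
    refine mul_nonneg (by positivity) ?_
    have h1 : δ ≤ 2*p/(6-p) * ((4-p)*s^2 - 2*(3-p)*s + (p-2)*M) := by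
      have : 1 ≤ 2*p/(6-p) := by
        rw [one_le_div hp6]
        linarith
      nlinarith [hδ s hs0]
    have h2 : -(20 + 12*M) ≤ 4*(p-3)*s^2 - (10*p-24)*s - 6*(p-2)*M := by
      have hs2 : s^2 ≤ 1 := pow_le_one₀ hs0 hs1
      have : -1 ≤ (p-3)*s^2 := by nlinarith [sq_nonneg s]
      nlinarith
    nlinarith
end

section
/- Let 2 < p < 3 and define K_p(α) = p²(1-2α)²/(8(p-2)(1-6α)(1+2α(p-3))). Then the infimum of K_p over the interval ((2-p)/(2(6-p)), 1/6) equals 1/((p-2)(4-p)); moreover K_p(α) > 1/((p-2)(4-p)) for every α in this interval. -/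
/-- The function `K_p(α)` from the proof of Lemma A.1. -/
noncomputable def Kp (p α : ℝ) : ℝ :=
  p^2 * (1-2*α)^2 / (8*(p-2)*(1-6*α)*(1 + 2*α*(p-3)))

theorem Kp_left_endpoint {p : ℝ} (hp2 : 2 < p) (hp4 : p < 4) :
    Kp p ((2-p)/(2*(6-p))) = 1/((p-2)*(4-p)) := by
  have h6 : 6 - p ≠ 0 := by linarith
  have h2 : p - 2 ≠ 0 := by linarith
  have h4 : 4 - p ≠ 0 := by linarith
  have h0 : p ≠ 0 := by linarith
  have e1 : 1 - 2*((2-p)/(2*(6-p))) = 4/(6-p) := by field_simp; ring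
  have e2 : 1 - 6*((2-p)/(2*(6-p))) = 2*p/(6-p) := by field_simp; ring
  have e3 : 1 + 2*((2-p)/(2*(6-p)))*(p-3) = p*(4-p)/(6-p) := by field_simp; ring
  rw [Kp, e1, e2, e3]
  field_simp
  norm_num

theorem Kp_denom_pos {p α : ℝ} (hp2 : 2 < p) (hp3 : p < 3)
    (hα : α ∈ Set.Ico ((2-p)/(2*(6-p))) (1/6 : ℝ)) :
    0 < 8*(p-2)*(1-6*α)*(1 + 2*α*(p-3)) := by
  have h1 : 0 < 1 - 6*α := by linarith [hα.2]
  have h2 : 0 < 1 + 2*α*(p-3) := by nlinarith [hα.2]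
  have h3 : 0 < p - 2 := by linarith
  positivity

theorem lt_Kp {p α : ℝ} (hp2 : 2 < p) (hp3 : p < 3)
    (hα : α ∈ Set.Ioo ((2-p)/(2*(6-p))) (1/6 : ℝ)) :
    1/((p-2)*(4-p)) < Kp p α := by
  have hd := Kp_denom_pos hp2 hp3 (Set.Ioo_subset_Ico_self hα)
  have hleft : 0 < 2*α*(6-p) + (p-2) := by
    have := hα.1
    rw [div_lt_iff₀ (by linarith)] at this
    linarith
  have hright : 0 < 1 - 6*α := by linarith [hα.2]
  have hfac : 0 < (p^2+2*p-12)*(2*α) + (4+2*p-p^2) := by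
    have h1 : 0 < (p*(4-p)) * (2*α*(6-p) + (p-2)) :=
      mul_pos (mul_pos (by linarith) (by linarith)) hleft
    have h2 : 0 < (4*p*(3-p)) * (1 - 6*α) :=
      mul_pos (mul_pos (by linarith) (by linarith)) hright
    have h3 : 0 < p * ((p^2+2*p-12)*(2*α) + (4+2*p-p^2)) := by
      linear_combination h1 + h2
    exact pos_of_mul_pos_right h3 (by linarith)
  rw [Kp, div_lt_div_iff₀ (mul_pos (by linarith) (by linarith)) hd]
  have h := mul_pos (sub_pos.2 hp2) (mul_pos hleft hfac)
  linear_combination h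

theorem Kp_inf (p : ℝ) (hp2 : 2 < p) (hp3 : p < 3) :
    IsGLB (Kp p '' Set.Ioo ((2-p)/(2*(6-p))) (1/6 : ℝ)) (1/((p-2)*(4-p))) ∧
      ∀ α ∈ Set.Ioo ((2-p)/(2*(6-p))) (1/6 : ℝ), Kp p α > 1/((p-2)*(4-p)) := by
  refine ⟨⟨?_, fun b hb => ?_⟩, fun α hα => lt_Kp hp2 hp3 hα⟩
  · rintro _ ⟨α, hα, rfl⟩
    exact (lt_Kp hp2 hp3 hα).le
  · have hlt : (2-p)/(2*(6-p)) < 1/6 := by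
      rw [div_lt_iff₀ (by linarith)]
      linarith
    have hcont : ContinuousAt (Kp p) ((2-p)/(2*(6-p))) := by
      unfold Kp
      exact ContinuousAt.div (by fun_prop) (by fun_prop)
        (Kp_denom_pos hp2 hp3 (Set.left_mem_Ico.2 hlt)).ne'
    rw [← Kp_left_endpoint hp2 (by linarith)]
    refine ge_of_tendsto (hcont.tendsto.mono_left
      (nhdsWithin_le_nhds (s := Set.Ioi ((2-p)/(2*(6-p)))))) ?_
    filter_upwards [Ioo_mem_nhdsGT hlt] with α hα
    exact hb ⟨α, hα, rfl⟩
end
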